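/- arXiv:2508.19149 — 2 statements merged into one kernel-verified Lean document; each statement's English description precedes it below -/
import Mathlib

section
/- For each collective c, under the feature-label signal strategy, if the classifier m is ε-suboptimal on X under the mixture distribution P, the per-collective uniqueness bound P_0^X(X_c*) ≤ ξ_c holds, and the global uniqueness bound P_j^X(X_c*) ≤ ξ holds for all j ≠ c, then the per-collective success satisfies S_c(α_c) ≥ 1 − ξ_c · (Δ_c + 2ε)/(1 − 2ε) · (1 − ᾱ)/α_c − ξ · (1 + 2ε)/(1 − 2ε) · (ᾱ − α_c − β_c)/α_c. -/
open Finset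

/-- A distribution on a finite set: nonnegative and sums to 1. -/
def IsDist {S : Type*} [Fintype S] (f : S → ℝ) : Prop :=
  (∀ s, 0 ≤ f s) ∧ ∑ s, f s = 1

/-- X-marginal of a distribution on `X × Y`. -/
noncomputable def margX {X Y : Type*} [Fintype Y] (μ : X × Y → ℝ) (x : X) : ℝ :=
  ∑ y, μ (x, y)

/-- Y-marginal of a distribution on `X × Y`. -/
noncomputable def margY {X Y : Type*} [Fintype X] (μ : X × Y → ℝ) (y : Y) : ℝ :=
  ∑ x, μ (x, y)

/-- Conditional probability of label `y` given features `x`. -/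
noncomputable def condY {X Y : Type*} [Fintype Y] (μ : X × Y → ℝ) (x : X) (y : Y) : ℝ :=
  μ (x, y) / margX μ x

/-- Pushforward of a distribution on a finite set under a map. -/
noncomputable def pushforward {Z : Type*} [Fintype Z] [DecidableEq Z]
    (μ : Z → ℝ) (h : Z → Z) (z : Z) : ℝ :=
  ∑ w, if h w = z then μ w else 0

/-- A classifier `m` is `ε`-suboptimal on `X'` under `P`: for every `x ∈ X'` there is a
distribution `q` on labels at total-variation distance at most `ε` from `P(·∣x)` such that
`m x` maximizes `q`. -/
def Suboptimal {X Y : Type*} [Fintype Y] (m : X → Y) (ε : ℝ) (X' : Set X)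
    (P : X × Y → ℝ) : Prop :=
  ∀ x ∈ X', ∃ q : Y → ℝ, (∀ y, 0 ≤ q y) ∧ (∑ y, q y = 1) ∧
    (1 / 2) * (∑ y, |q y - condY P x y|) ≤ ε ∧ ∀ y, q y ≤ q (m x)

/-- Feature marginal of `P0` transported along a feature map. -/
noncomputable def featurePush {X Y : Type*} [Fintype X] [Fintype Y] [DecidableEq X]
    (P0 : X × Y → ℝ) (f : X → X) (x : X) : ℝ :=
  ∑ x', if f x' = x then margX P0 x' else 0

lemma pushforward_feature_label {X Y : Type*} [Fintype X] [Fintype Y] [DecidableEq X]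
    [DecidableEq Y] (P0 : X × Y → ℝ) (f : X → X) (b : Y) (x : X) (y : Y) :
    pushforward P0 (fun w => (f w.1, b)) (x, y) = if b = y then featurePush P0 f x else 0 := by
  unfold pushforward featurePush margX
  rw [Fintype.sum_prod_type]
  by_cases h : b = y
  · simp only [Prod.mk.injEq, h, and_true, if_true]
    refine Finset.sum_congr rfl fun x' _ => ?_
    split_ifs <;> simp
  · simp [h]

lemma margX_pushforward_feature_label {X Y : Type*} [Fintype X] [Fintype Y] [DecidableEq X]
    [DecidableEq Y] (P0 : X × Y → ℝ) (f : X → X) (b : Y) (x : X) :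
    margX (pushforward P0 (fun w => (f w.1, b))) x = featurePush P0 f x := by
  simp [margX, pushforward_feature_label]

lemma featurePush_nonneg {X Y : Type*} [Fintype X] [Fintype Y] [DecidableEq X]
    {P0 : X × Y → ℝ} (h : ∀ x, 0 ≤ margX P0 x) (f : X → X) (x : X) :
    0 ≤ featurePush P0 f x :=
  Finset.sum_nonneg fun x' _ => by split_ifs <;> simp [h]

/-- Change of variables for the transported feature marginal. -/
lemma sum_image_featurePush_mul {X Y : Type*} [Fintype X] [Fintype Y] [DecidableEq X]
    (P0 : X × Y → ℝ) (f : X → X) (φ : X → ℝ) :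
    ∑ x ∈ Finset.univ.image f, featurePush P0 f x * φ x = ∑ x, margX P0 x * φ (f x) := by
  simp only [featurePush, Finset.sum_mul]
  rw [Finset.sum_comm]
  refine Finset.sum_congr rfl fun x' _ => ?_
  simp [ite_mul]

/-- A label predicted by an `ε`-suboptimal classifier has joint mass within `2ε` times the
feature mass of that of any other label. -/
lemma Suboptimal.sub_le {X Y : Type*} [Fintype Y] [DecidableEq Y] {m : X → Y} {ε : ℝ}
    {X' : Set X} {P : X × Y → ℝ} (h : Suboptimal m ε X' P) {x : X} (hx : x ∈ X')
    (hPx : 0 < margX P x) {y : Y} (hy : m x ≠ y) :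
    P (x, y) - P (x, m x) ≤ 2 * ε * margX P x := by
  obtain ⟨q, -, -, htv, hmax⟩ := h x hx
  have hpair : |q (m x) - condY P x (m x)| + |q y - condY P x y| ≤
      ∑ y, |q y - condY P x y| := by
    rw [← Finset.sum_pair (f := fun y => |q y - condY P x y|) hy]
    exact Finset.sum_le_sum_of_subset_of_nonneg (Finset.subset_univ _)
      fun _ _ _ => abs_nonneg _
  have h₁ := le_abs_self (q (m x) - condY P x (m x))
  have h₂ := neg_abs_le (q y - condY P x y)
  have hcond : condY P x y - condY P x (m x) ≤ 2 * ε := by linarith [hmax y]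
  rwa [condY, condY, ← sub_div, div_le_iff₀ hPx] at hcond

/-- Per-collective success lower bound under the feature-label signal
strategy (Theorem 1 of the paper). -/
theorem stmt2 {X Y : Type*} [Fintype X] [Fintype Y] [DecidableEq X] [DecidableEq Y]
    [Nonempty X] [Nonempty Y]
    (hY : 2 ≤ Fintype.card Y)
    -- the base distribution
    (P0 : X × Y → ℝ) (hP0 : IsDist P0) (hpos : ∀ x, 0 < margX P0 x)
    -- the collectives: masses, feature maps, target labels
    (M : ℕ) (hM : 1 ≤ M)
    (α : Fin M → ℝ) (hα : ∀ c, 0 < α c) (htot : ∑ i, α i ≤ 1)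
    (g : Fin M → X → X) (ystar : Fin M → Y)
    -- the mixture distribution under the feature-label strategy
    (P : X × Y → ℝ)
    (hP : P = fun z => (1 - ∑ i, α i) * P0 z +
      ∑ j, α j * pushforward P0 (fun w => (g j w.1, ystar j)) z)
    -- the ε-suboptimal classifier
    (ε : ℝ) (hε0 : 0 ≤ ε) (hε : ε < 1 / 2)
    (m : X → Y) (hsub : Suboptimal m ε Set.univ P)
    -- the fixed collective c and the uniqueness parameters
    (c : Fin M) (ξc ξ : ℝ)
    (hξc : ∑ x' ∈ Finset.univ.image (g c), margX P0 x' ≤ ξc)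
    (hξ : ∀ j, j ≠ c →
      ∑ x' ∈ Finset.univ.image (g c),
        margX (pushforward P0 (fun w => (g j w.1, ystar j))) x' ≤ ξ)
    -- the suboptimality gap
    (Δc : ℝ)
    (hΔ : Δc = (Finset.univ.image (g c)).sup'
      (Finset.image_nonempty.mpr Finset.univ_nonempty)
      (fun x => (Finset.univ.sup' Finset.univ_nonempty (fun y => condY P0 x y))
        - condY P0 x (ystar c)))
    -- the target alignment
    (βc : ℝ)
    (hβ : βc = ∑ j ∈ Finset.univ.filter (fun j => j ≠ c ∧ ystar j = ystar c), α j) :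
    1 - ξc * ((Δc + 2 * ε) / (1 - 2 * ε)) * ((1 - ∑ i, α i) / α c)
      - ξ * ((1 + 2 * ε) / (1 - 2 * ε)) * ((∑ i, α i - α c - βc) / α c)
    ≤ ∑ x, margX P0 x * (if m (g c x) = ystar c then (1 : ℝ) else 0) := by
  have hnn : ∀ x, 0 ≤ margX P0 x := fun x => (hpos x).le
  have hApos : ∀ j x, 0 ≤ featurePush P0 (g j) x := fun j x => featurePush_nonneg hnn _ _
  simp only [margX_pushforward_feature_label] at hξ
  set a := ∑ i, α i with ha
  have hPv : ∀ x y, P (x, y) = (1 - a) * P0 (x, y) +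
      ∑ j, α j * (if ystar j = y then featurePush P0 (g j) x else 0) := by
    intro x y
    simp only [hP, pushforward_feature_label]
  have hPX : ∀ x, margX P x = (1 - a) * margX P0 x + ∑ j, α j * featurePush P0 (g j) x := by
    intro x
    unfold margX
    simp only [hPv, Finset.sum_add_distrib, ← Finset.mul_sum]
    rw [Finset.sum_comm]
    simp
  have ha1 : 0 ≤ 1 - a := by linarith
  have hgap : ∀ x ∈ Finset.univ.image (g c), ∀ y,
      condY P0 x y - condY P0 x (ystar c) ≤ Δc := by
    intro x hx y
    rw [hΔ]
    refine le_trans ?_ (Finset.le_sup' (fun x =>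
      (Finset.univ.sup' Finset.univ_nonempty (fun y => condY P0 x y))
        - condY P0 x (ystar c)) hx)
    exact sub_le_sub_right (Finset.le_sup' (fun y => condY P0 x y) (Finset.mem_univ y)) _
  have hΔ0 : 0 ≤ Δc := by
    obtain ⟨x⟩ := ‹Nonempty X›
    simpa using hgap (g c x) (by simp) (ystar c)
  set D : Fin M → ℝ := fun j => if ystar j = ystar c then 0 else 1 with hD
  have hD0 : ∀ j, 0 ≤ D j := fun j => by simp only [hD]; split_ifs <;> norm_num
  have hDsum : ∑ j, α j * D j = a - α c - βc := by
    have hsingle : α c = ∑ j, if j = c then α j else 0 := by simp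
    rw [ha, hβ, hsingle, Finset.sum_filter, ← Finset.sum_sub_distrib, ← Finset.sum_sub_distrib]
    refine Finset.sum_congr rfl fun j _ => ?_
    by_cases hjc : j = c
    · simp [hD, hjc]
    · by_cases hy : ystar j = ystar c <;> simp [hD, hjc, hy]
  set fail : X → ℝ := fun x => if m x = ystar c then 0 else 1 with hfail
  have hpoint : ∀ x ∈ Finset.univ.image (g c),
      α c * (1 - 2 * ε) * (featurePush P0 (g c) x * fail x) ≤
        (1 - a) * (Δc + 2 * ε) * margX P0 x +
          (1 + 2 * ε) * ∑ j, α j * D j * featurePush P0 (g j) x := by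
    intro x hx
    have hrest : 0 ≤ ∑ j, α j * D j * featurePush P0 (g j) x :=
      Finset.sum_nonneg fun j _ => mul_nonneg (mul_nonneg (hα j).le (hD0 j)) (hApos j x)
    by_cases hm : m x = ystar c
    · have := mul_nonneg (mul_nonneg ha1 (by linarith : 0 ≤ Δc + 2 * ε)) (hnn x)
      have := mul_nonneg (by linarith : 0 ≤ 1 + 2 * ε) hrest
      simp only [hfail, hm, if_true, mul_zero]
      linarith
    have hAc : 0 < featurePush P0 (g c) x := by
      obtain ⟨x₀, -, hx₀⟩ := Finset.mem_image.mp hx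
      refine Finset.sum_pos' (fun x' _ => ?_) ⟨x₀, Finset.mem_univ _, by simp [hx₀, hpos]⟩
      split_ifs <;> simp [hnn]
    have hPxpos : 0 < margX P x := by
      rw [hPX]
      have := Finset.single_le_sum (f := fun j => α j * featurePush P0 (g j) x)
        (fun j _ => mul_nonneg (hα j).le (hApos j x)) (Finset.mem_univ c)
      have := mul_pos (hα c) hAc
      have := mul_nonneg ha1 (hnn x)
      linarith
    have hle := hsub.sub_le (Set.mem_univ x) hPxpos hm
    rw [hPv, hPv, hPX] at hle
    have hbase : P0 (x, m x) - P0 (x, ystar c) ≤ Δc * margX P0 x := by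
      have := hgap x hx (m x)
      rwa [condY, condY, ← sub_div, div_le_iff₀ (hpos x)] at this
    have hbase' := mul_le_mul_of_nonneg_left hbase ha1
    have hcoll : α c * (1 - 2 * ε) * featurePush P0 (g c) x
          - (1 + 2 * ε) * ∑ j, α j * D j * featurePush P0 (g j) x ≤
        ∑ j, α j * (if ystar j = ystar c then featurePush P0 (g j) x else 0)
          - ∑ j, α j * (if ystar j = m x then featurePush P0 (g j) x else 0)
          - 2 * ε * ∑ j, α j * featurePush P0 (g j) x := by
      have hsingle : α c * (1 - 2 * ε) * featurePush P0 (g c) x =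
          ∑ j, if j = c then α j * (1 - 2 * ε) * featurePush P0 (g j) x else 0 := by simp
      rw [hsingle, Finset.mul_sum, Finset.mul_sum, ← Finset.sum_sub_distrib,
        ← Finset.sum_sub_distrib, ← Finset.sum_sub_distrib]
      refine Finset.sum_le_sum fun j _ => ?_
      have hαA := mul_nonneg (hα j).le (hApos j x)
      have hαAε := mul_nonneg hαA (by linarith : 0 ≤ 1 - 2 * ε)
      by_cases hy : ystar j = ystar c
      · have hym : ¬ ystar c = m x := fun h => hm h.symm
        by_cases hjc : j = c
        · subst hjc
          simp only [hD, hym, if_true, if_false]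
          linarith
        · simp only [hD, hy, hym, hjc, if_true, if_false]
          linarith
      · have hjc : j ≠ c := fun h => hy (h ▸ rfl)
        simp only [hD, hy, hjc, if_false]
        split_ifs <;> linarith
    simp only [hfail, hm, if_false]
    linarith
  have hsum := Finset.sum_le_sum hpoint
  rw [← Finset.mul_sum, Finset.sum_add_distrib, ← Finset.mul_sum, ← Finset.mul_sum,
    sum_image_featurePush_mul, Finset.sum_comm] at hsum
  simp only [← Finset.mul_sum] at hsum
  have hothers : ∑ j, α j * D j * ∑ x ∈ Finset.univ.image (g c), featurePush P0 (g j) x ≤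
      (a - α c - βc) * ξ := by
    rw [← hDsum, Finset.sum_mul]
    refine Finset.sum_le_sum fun j _ => ?_
    by_cases hjc : j = c
    · simp [hD, hjc]
    · exact mul_le_mul_of_nonneg_left (hξ j hjc) (mul_nonneg (hα j).le (hD0 j))
  have htotal : ∑ x, margX P0 x = 1 := by
    rw [← hP0.2, Fintype.sum_prod_type]
    rfl
  have hsucc : ∑ x, margX P0 x * (if m (g c x) = ystar c then (1 : ℝ) else 0) =
      1 - ∑ x, margX P0 x * fail (g c x) := by
    rw [eq_sub_iff_add_eq, ← Finset.sum_add_distrib]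
    refine (Finset.sum_congr rfl fun x _ => ?_).trans htotal
    simp only [hfail]
    split_ifs <;> simp
  have hbase := mul_le_mul_of_nonneg_left hξc
    (mul_nonneg ha1 (by linarith : 0 ≤ Δc + 2 * ε))
  have hothers' := mul_le_mul_of_nonneg_left hothers (by linarith : 0 ≤ 1 + 2 * ε)
  have hε' : 0 < 1 - 2 * ε := by linarith
  have hfinal : ∑ x, margX P0 x * fail (g c x) ≤
      ((1 - a) * (Δc + 2 * ε) * ξc + (1 + 2 * ε) * ((a - α c - βc) * ξ)) /
        (α c * (1 - 2 * ε)) := by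
    rw [le_div_iff₀ (mul_pos (hα c) hε')]
    linarith
  have hrw : ((1 - a) * (Δc + 2 * ε) * ξc + (1 + 2 * ε) * ((a - α c - βc) * ξ)) /
        (α c * (1 - 2 * ε)) =
      ξc * ((Δc + 2 * ε) / (1 - 2 * ε)) * ((1 - a) / α c)
        + ξ * ((1 + 2 * ε) / (1 - 2 * ε)) * ((a - α c - βc) / α c) := by
    have := (hα c).ne'
    have := hε'.ne'
    field_simp
  rw [hsucc]
  linarith
end

section
/- Under the feature-only strategy for all M collectives, the X-marginal of the mixture distribution P = (1 − ᾱ)P_0 + Σ_{j=1}^M α_j P_j satisfies, for every x ∈ X and every collective c, P^X(x) ≤ P_0^X(x) + S_al(x) + S_ctr(x), where S_al(x) = Σ_{j : y_j* = y_c*} α_j·P_0^Y(y_j*)·Q_j^X(x) and S_ctr(x) = Σ_{j : y_j* ≠ y_c*} α_j·P_j^X(x). -/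
open Finset

/-- The marginal of a pushforward sums the mass of all points whose image has first
coordinate `x`. -/
lemma margX_pushforward {X Y : Type*} [Fintype X] [Fintype Y] [DecidableEq X] [DecidableEq Y]
    (μ : X × Y → ℝ) (h : X × Y → X × Y) (x : X) :
    margX (pushforward μ h) x = ∑ w, if (h w).1 = x then μ w else 0 := by
  unfold margX pushforward
  rw [Finset.sum_comm]
  refine Finset.sum_congr rfl fun w _ => ?_
  by_cases hx : (h w).1 = x
  · simp [Prod.ext_iff, hx]
  · simp [Prod.ext_iff, hx]

/-- Moving only the features of points labelled `y₀` adds at most the moved mass to the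
marginal at `x`. -/
lemma margX_pushforward_feature_le {X Y : Type*} [Fintype X] [Fintype Y] [DecidableEq X]
    [DecidableEq Y] (μ : X × Y → ℝ) (hμ : ∀ z, 0 ≤ μ z) (f : X → X) (y₀ : Y) (x : X) :
    margX (pushforward μ (fun w => if w.2 = y₀ then (f w.1, w.2) else w)) x ≤
      margX μ x + ∑ x' ∈ Finset.univ.filter (fun x' => f x' = x), μ (x', y₀) := by
  have hbase : margX μ x = ∑ w : X × Y, if w.1 = x then μ w else 0 := by
    simp [margX, Fintype.sum_prod_type_right]
  have hmoved : ∑ x' ∈ Finset.univ.filter (fun x' => f x' = x), μ (x', y₀) =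
      ∑ w : X × Y, if w.2 = y₀ then (if f w.1 = x then μ w else 0) else 0 := by
    simp [Fintype.sum_prod_type, Finset.sum_filter]
  rw [margX_pushforward, hbase, hmoved, ← Finset.sum_add_distrib]
  refine Finset.sum_le_sum fun w _ => ?_
  have hw := hμ w
  by_cases hy : w.2 = y₀ <;> simp only [hy, if_true, if_false] <;> split_ifs <;> linarith

/-- Mixture marginal upper bound under the feature-only strategy:
`P^X(x) ≤ P_0^X(x) + S_al(x) + S_ctr(x)`. -/
theorem stmt11 {X Y : Type*} [Fintype X] [Fintype Y] [DecidableEq X] [DecidableEq Y]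
    (P0 : X × Y → ℝ) (hP0 : IsDist P0)
    (M : ℕ) (hM : 1 ≤ M)
    (α : Fin M → ℝ) (hα : ∀ j, 0 < α j) (htot : ∑ j, α j ≤ 1)
    (g : Fin M → X → X) (ystar : Fin M → Y)
    (hYpos : ∀ j, 0 < margY P0 (ystar j))
    (P : X × Y → ℝ)
    (hP : P = fun z => (1 - ∑ j, α j) * P0 z +
      ∑ j, α j * pushforward P0 (fun w => if w.2 = ystar j then (g j w.1, w.2) else w) z)
    (c : Fin M)
    -- the aligned mass
    (Sal : X → ℝ)
    (hSal : ∀ x, Sal x = ∑ j ∈ Finset.univ.filter (fun j => ystar j = ystar c),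
      α j * (margY P0 (ystar j) *
        ∑ x' ∈ Finset.univ.filter (fun x' => g j x' = x),
          P0 (x', ystar j) / margY P0 (ystar j)))
    -- the contradicting mass
    (Sctr : X → ℝ)
    (hSctr : ∀ x, Sctr x = ∑ j ∈ Finset.univ.filter (fun j => ystar j ≠ ystar c),
      α j * margX (pushforward P0 (fun w => if w.2 = ystar j then (g j w.1, w.2) else w)) x) :
    ∀ x : X, margX P x ≤ margX P0 x + Sal x + Sctr x := by
  intro x
  set R : Fin M → ℝ := fun j =>
    margX (pushforward P0 (fun w => if w.2 = ystar j then (g j w.1, w.2) else w)) x with hR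
  have hmix : margX P x = (1 - ∑ j, α j) * margX P0 x + ∑ j, α j * R j := by
    simp only [hP, hR, margX, Finset.sum_add_distrib, Finset.mul_sum]
    rw [Finset.sum_comm (s := (Finset.univ : Finset Y))]
  have hnonneg : 0 ≤ margX P0 x := Finset.sum_nonneg fun y _ => hP0.1 _
  have hmass : ∑ j ∈ Finset.univ.filter (fun j => ystar j = ystar c), α j ≤ ∑ j, α j :=
    Finset.sum_le_sum_of_subset_of_nonneg (Finset.filter_subset _ _) fun j _ _ => (hα j).le
  have hal : ∑ j ∈ Finset.univ.filter (fun j => ystar j = ystar c), α j * R j ≤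
      (∑ j ∈ Finset.univ.filter (fun j => ystar j = ystar c), α j) * margX P0 x + Sal x := by
    rw [hSal, Finset.sum_mul, ← Finset.sum_add_distrib]
    refine Finset.sum_le_sum fun j _ => ?_
    rw [← Finset.sum_div, mul_div_cancel₀ _ (hYpos j).ne', ← mul_add]
    exact mul_le_mul_of_nonneg_left
      (margX_pushforward_feature_le P0 hP0.1 (g j) (ystar j) x) (hα j).le
  have hsplit := Finset.sum_filter_add_sum_filter_not Finset.univ
    (fun j => ystar j = ystar c) (fun j => α j * R j)
  have hctr : Sctr x =
      ∑ j ∈ Finset.univ.filter (fun j => ¬ ystar j = ystar c), α j * R j := hSctr x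
  have hscaled := mul_le_mul_of_nonneg_right hmass hnonneg
  linarith
end
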